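/- Let $R > 0$, let $\xi, M : (0,R] \to \mathbb{R}$ be differentiable with $\xi > 0$ and $r - 2M(r) > 0$, let $p, \rho : (0,R] \to \mathbb{R}$ be continuous with $M' = 4\pi r^2\rho$, set $\lambda = (1-2M/r)^{-1/2}$, and suppose the function $G(r) = 4\pi r\,\xi(p+\rho)\lambda^3 - (\lambda\xi)'$ extends continuously to $[0,R]$. If $\bigl[1 - \lambda(R)\xi(R)\bigr] h(R) - \int_0^R G(r)\,h(r)\,dr = 0$ for every infinitely differentiable $h : [0,R] \to \mathbb{R}$ with $h(0) = 0$, then $\xi$ satisfies Einstein's field equation $\xi'(r) = \xi(r)\,(M(r) + 4\pi r^3 p(r))/(r(r - 2M(r)))$ on $(0,R]$ together with the boundary condition $\xi(R) = (1 - 2M(R)/R)^{1/2}$. -/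

import Mathlib

open Set Real intervalIntegral

/-- The radial metric function `λ(r) = (1 - 2M(r)/r)^(-1/2)` of a static,
spherically symmetric metric with mass function `M`. -/
noncomputable def lamFn (M : ℝ → ℝ) (r : ℝ) : ℝ :=
  (Real.sqrt (1 - 2 * M r / r))⁻¹

/-- A continuous function on `[a, b]` that is orthogonal to every smooth function compactly
supported in `(a, b)` vanishes on `[a, b]`. -/
theorem eqOn_zero_of_integral_contDiff_mul_eq_zero {a b : ℝ} (hab : a < b) {g : ℝ → ℝ}
    (hg : ContinuousOn g (Icc a b))
    (h : ∀ f : ℝ → ℝ, ContDiff ℝ (⊤ : ℕ∞) f → HasCompactSupport f → tsupport f ⊆ Ioo a b →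
      ∫ x in a..b, g x * f x = 0) :
    EqOn g 0 (Icc a b) := by
  have hg' : ContinuousOn g (Ioo a b) := hg.mono Ioo_subset_Icc_self
  have hae : ∀ᵐ x, x ∈ Ioo a b → g x = 0 := by
    refine isOpen_Ioo.ae_eq_zero_of_integral_contDiff_smul_eq_zero
      (hg'.locallyIntegrableOn measurableSet_Ioo) fun f hf hfc hfs => ?_
    rw [← h f hf hfc hfs, integral_of_le hab.le]
    symm
    simp only [smul_eq_mul, mul_comm (g _)]
    refine MeasureTheory.setIntegral_eq_integral_of_forall_compl_eq_zero fun x hx => ?_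
    have hx' : x ∉ tsupport f := fun hx' => hx (Ioo_subset_Ioc_self (hfs hx'))
    rw [image_eq_zero_of_notMem_tsupport hx', zero_mul]
  have hae' : g =ᵐ[MeasureTheory.volume.restrict (Icc a b)] 0 := by
    rw [← MeasureTheory.restrict_Ioo_eq_restrict_Icc]
    exact (MeasureTheory.ae_restrict_iff' measurableSet_Ioo).2 hae
  exact MeasureTheory.Measure.eqOn_Icc_of_ae_eq _ hab.ne hae' hg continuousOn_const

theorem one_sub_two_mul_div_pos {m r : ℝ} (hr : 0 < r) (h : 0 < r - 2 * m) :
    0 < 1 - 2 * m / r := by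
  rw [one_sub_div hr.ne']
  exact div_pos h hr

theorem lamFn_pos {M : ℝ → ℝ} {r : ℝ} (hr : 0 < r) (h : 0 < r - 2 * M r) : 0 < lamFn M r :=
  inv_pos.2 (Real.sqrt_pos.2 (one_sub_two_mul_div_pos hr h))

theorem lamFn_sq {M : ℝ → ℝ} {r : ℝ} (hr : 0 < r) (h : 0 < r - 2 * M r) :
    lamFn M r ^ 2 = r / (r - 2 * M r) := by
  rw [lamFn, inv_pow, Real.sq_sqrt (one_sub_two_mul_div_pos hr h).le, one_sub_div hr.ne', inv_div]

theorem hasDerivAt_lamFn {M : ℝ → ℝ} {m' r : ℝ} (hr : 0 < r) (h : 0 < r - 2 * M r)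
    (hM : HasDerivAt M m' r) :
    HasDerivAt (lamFn M) (lamFn M r ^ 3 * (m' / r - M r / r ^ 2)) r := by
  have hu := one_sub_two_mul_div_pos hr h
  have hs := Real.sqrt_pos.2 hu
  have hd := ((((hM.const_mul 2).fun_div (hasDerivAt_id' r) hr.ne').const_sub 1).sqrt hu.ne').fun_inv
    hs.ne'
  refine hd.congr_deriv ?_
  simp only [lamFn]
  field_simp

/-- **Converse direction of the paper's Theorem 1** at the level of the first
variation: if the first variation of the free energy,
`δF = [1-λ(R)ξ(R)] δM(R) - ∫₀ᴿ G δM dr` with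
`G = 4πr ξ(p+ρ)λ³ - (λξ)'`, vanishes for all variations `δM` with `δM(0) = 0`,
then Einstein's field equation and the matching boundary condition hold. -/
theorem free_energy_extremum_implies_einstein
    (R : ℝ) (hR : 0 < R) (ξ M p ρ : ℝ → ℝ)
    (hξd : ∀ r ∈ Ioc (0:ℝ) R, DifferentiableAt ℝ ξ r)
    (hMd : ∀ r ∈ Ioc (0:ℝ) R, DifferentiableAt ℝ M r)
    (hξpos : ∀ r ∈ Ioc (0:ℝ) R, 0 < ξ r)
    (hhoriz : ∀ r ∈ Ioc (0:ℝ) R, 0 < r - 2 * M r)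
    (hpc : ContinuousOn p (Ioc 0 R))
    (hρc : ContinuousOn ρ (Ioc 0 R))
    (hM' : ∀ r ∈ Ioc (0:ℝ) R, deriv M r = 4 * π * r ^ 2 * ρ r)
    -- G extends continuously to [0,R]
    (G : ℝ → ℝ) (hGc : ContinuousOn G (Icc 0 R))
    (hGeq : ∀ r ∈ Ioc (0:ℝ) R,
      G r = 4 * π * r * ξ r * (p r + ρ r) * (lamFn M r) ^ 3
        - deriv (fun r' => lamFn M r' * ξ r') r)
    -- vanishing of the first variation for all admissible variations
    (hvar : ∀ h : ℝ → ℝ, ContDiff ℝ (⊤ : ℕ∞) h → h 0 = 0 →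
      (1 - lamFn M R * ξ R) * h R - ∫ r in (0:ℝ)..R, G r * h r = 0) :
    (∀ r ∈ Ioc (0:ℝ) R,
      deriv ξ r = ξ r * (M r + 4 * π * r ^ 3 * p r) / (r * (r - 2 * M r))) ∧
    ξ R = Real.sqrt (1 - 2 * M R / R) := by
  have hG : EqOn G 0 (Icc 0 R) := by
    refine eqOn_zero_of_integral_contDiff_mul_eq_zero hR hGc fun f hf _ hfs => ?_
    have h0 : f 0 = 0 := image_eq_zero_of_notMem_tsupport fun h => lt_irrefl _ (hfs h).1
    have hfR : f R = 0 := image_eq_zero_of_notMem_tsupport fun h => lt_irrefl _ (hfs h).2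
    simpa [hfR] using hvar f hf h0
  refine ⟨fun r hr => ?_, ?_⟩
  · have hr0 := hr.1
    have hh := hhoriz r hr
    have hlam := lamFn_pos hr0 hh
    have hM := (hMd r hr).hasDerivAt
    rw [hM' r hr] at hM
    have hd := ((hasDerivAt_lamFn hr0 hh hM).fun_mul (hξd r hr).hasDerivAt).deriv
    have hEq := hGeq r hr
    have hdiv : 4 * π * r ^ 2 * ρ r / r = 4 * π * r * ρ r := by field_simp
    rw [hG (Ioc_subset_Icc_self hr), hd, Pi.zero_apply, hdiv] at hEq
    have key : deriv ξ r = lamFn M r ^ 2 * (ξ r * (4 * π * r * p r + M r / r ^ 2)) := by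
      refine mul_left_cancel₀ hlam.ne' ?_
      linear_combination hEq
    rw [key, lamFn_sq hr0 hh]
    field_simp
    ring
  · have hRR : R ∈ Ioc 0 R := ⟨hR, le_rfl⟩
    have hint : ∫ r in (0:ℝ)..R, G r * r = 0 := by
      refine (integral_congr fun r hr => ?_).trans integral_zero
      rw [uIcc_of_le hR.le] at hr
      simp [hG hr]
    have hb := hvar id contDiff_id rfl
    simp only [id, hint, sub_zero, mul_eq_zero, hR.ne', or_false, sub_eq_zero] at hb
    have hs := Real.sqrt_pos.2 (one_sub_two_mul_div_pos hR (hhoriz R hRR))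
    rw [lamFn, inv_mul_eq_div, eq_div_iff hs.ne', one_mul] at hb
    exact hb.symm
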